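/- Let $t, T > 0$ satisfy $\sinh(T/2)\,\sinh(t/2) = 1$. Then $e^{2T}\Big(\cosh(T)\,\log\big(\tfrac{\cosh(T)+1}{\cosh(T)-1}\big) - 2\Big) \;\le\; \frac{8}{3} + t.$ -/

import Mathlib

/-- The function `a(T) = e^{2T} (cosh T * log((cosh T + 1)/(cosh T - 1)) - 2)`. -/
noncomputable def aFun (T : ℝ) : ℝ :=
  Real.exp (2 * T) * (Real.cosh T * Real.log ((Real.cosh T + 1) / (Real.cosh T - 1)) - 2)

/-- Comparison of the power series of `log ((1 + q) / (1 - q))` and `-log (1 - q ^ 2)`. -/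
theorem one_add_sq_mul_log_sub_log_le {q : ℝ} (hq : 0 < q) (hq1 : q < 1) :
    (1 + q ^ 2) * (Real.log (1 + q) - Real.log (1 - q)) - 2 * q - 8 / 3 * q ^ 3
      ≤ 2 * q ^ 3 * -Real.log (1 - q ^ 2) := by
  have hL := Real.hasSum_log_sub_log_of_abs_lt_one (abs_lt.2 ⟨by linarith, hq1⟩)
  have hsq : |q ^ 2| < 1 := by
    rw [abs_of_pos (by positivity)]
    nlinarith
  have hG := (Real.hasSum_pow_div_log_of_abs_lt_one hsq).mul_left (2 * q ^ 3)
  have hF := (hL.mul_left (q ^ 2)).add ((hasSum_nat_add_iff' 1).2 hL)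
  have hF' := (hasSum_nat_add_iff' 1).2 hF
  have key := hasSum_le (fun k => ?_) hF' hG
  · norm_num at key
    linarith
  · push_cast
    have e : (2 : ℝ) * (1 / (2 * (k + 1) + 1)) + 2 * (1 / (2 * (k + 1 + 1) + 1))
        ≤ 2 / (k + 1) := by
      have h1 : (1 : ℝ) / (2 * (k + 1) + 1) ≤ 1 / (2 * (k + 1)) := by gcongr; linarith
      have h2 : (1 : ℝ) / (2 * (k + 1 + 1) + 1) ≤ 1 / (2 * (k + 1)) := by gcongr; linarith
      have h3 : (2 : ℝ) / (k + 1) = 4 * (1 / (2 * (k + 1))) := by field_simp; norm_num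
      linarith
    calc _ = (2 * (1 / (2 * ((k : ℝ) + 1) + 1)) + 2 * (1 / (2 * (k + 1 + 1) + 1)))
          * q ^ (2 * k + 5) := by ring
      _ ≤ 2 / (k + 1) * q ^ (2 * k + 5) := by gcongr
      _ = _ := by ring

/-- The function `aFun` in terms of `q = e^{-T}`. -/
theorem aFun_eq_exp_neg {T : ℝ} (hT : 0 < T) :
    aFun T = ((1 + Real.exp (-T) ^ 2)
      * (Real.log (1 + Real.exp (-T)) - Real.log (1 - Real.exp (-T))) - 2 * Real.exp (-T))
        / Real.exp (-T) ^ 3 := by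
  have hE : Real.exp T = (Real.exp (-T))⁻¹ := by rw [Real.exp_neg, inv_inv]
  have hq1 : Real.exp (-T) < 1 := Real.exp_lt_one_iff.2 (by linarith)
  have hq := Real.exp_pos (-T)
  rw [aFun, two_mul, Real.exp_add, Real.cosh_eq, hE]
  generalize Real.exp (-T) = q at *
  have h1 : 0 < 1 - q := by linarith
  have harg : ((q⁻¹ + q) / 2 + 1) / ((q⁻¹ + q) / 2 - 1) = ((1 + q) / (1 - q)) ^ 2 := by
    have h2 : (q⁻¹ + q) / 2 + 1 = (1 + q) ^ 2 / (2 * q) := by field_simp; ring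
    have h3 : (q⁻¹ + q) / 2 - 1 = (1 - q) ^ 2 / (2 * q) := by field_simp; ring
    rw [h2, h3]
    field_simp
  rw [harg, Real.log_pow, Real.log_div (by positivity) h1.ne']
  field_simp
  push_cast
  ring

theorem cosh_half_mul_one_sub_exp_neg {t T : ℝ} (hT : 0 < T)
    (h : Real.sinh (T / 2) * Real.sinh (t / 2) = 1) :
    Real.cosh (t / 2) * (1 - Real.exp (-T)) = 1 + Real.exp (-T) := by
  have hq1 : Real.exp (-T) < 1 := Real.exp_lt_one_iff.2 (by linarith)
  have hx := Real.cosh_sq (t / 2)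
  have hs : 4 * Real.exp (-T) * Real.sinh (T / 2) ^ 2 = (1 - Real.exp (-T)) ^ 2 := by
    have h1 : Real.exp (-T) = Real.exp (-(T / 2)) ^ 2 := by
      rw [← Real.exp_nat_mul]
      congr 1
      push_cast
      ring
    have h2 : Real.exp (T / 2) * Real.exp (-(T / 2)) = 1 := by
      rw [← Real.exp_add]
      simp
    rw [Real.sinh_eq, h1]
    linear_combination (Real.exp (T / 2) * Real.exp (-(T / 2)) + 1
      - 2 * Real.exp (-(T / 2)) ^ 2) * h2
  have hq := Real.exp_pos (-T)
  have hc := Real.cosh_pos (t / 2)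
  refine (pow_left_inj₀ (mul_nonneg hc.le (by linarith)) (by positivity) two_ne_zero).1 ?_
  rw [mul_pow, hx, ← hs]
  linear_combination 4 * Real.exp (-T)
    * (Real.sinh (T / 2) * Real.sinh (t / 2) + 1) * h + hs

theorem neg_log_one_sub_exp_neg_sq_le {t T : ℝ} (ht : 0 < t) (hT : 0 < T)
    (h : Real.sinh (T / 2) * Real.sinh (t / 2) = 1) :
    -Real.log (1 - Real.exp (-T) ^ 2) ≤ t / 2 := by
  have hc := cosh_half_mul_one_sub_exp_neg hT h
  have hq1 : Real.exp (-T) < 1 := Real.exp_lt_one_iff.2 (by linarith)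
  have hq := Real.exp_pos (-T)
  have hcE : Real.cosh (t / 2) ≤ Real.exp (t / 2) := by
    rw [← Real.cosh_add_sinh]
    linarith [Real.sinh_pos_iff.2 (half_pos ht)]
  have hpos : 0 < 1 - Real.exp (-T) ^ 2 := by nlinarith
  rw [neg_le, Real.le_log_iff_exp_le hpos, Real.exp_neg, inv_le_iff_one_le_mul₀ (Real.exp_pos _)]
  calc (1 : ℝ) ≤ (1 + Real.exp (-T)) ^ 2 := by nlinarith
    _ = (1 - Real.exp (-T) ^ 2) * Real.cosh (t / 2) := by
      linear_combination -(1 + Real.exp (-T)) * hc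
    _ ≤ _ := by gcongr

/-- if `t, T > 0` satisfy `sinh(T/2) sinh(t/2) = 1`, then `a(T) ≤ 8/3 + t`. -/
theorem stmt8 (t T : ℝ) (ht : 0 < t) (hT : 0 < T)
    (h : Real.sinh (T / 2) * Real.sinh (t / 2) = 1) :
    aFun T ≤ 8 / 3 + t := by
  have hq := Real.exp_pos (-T)
  have hseries := one_add_sq_mul_log_sub_log_le hq (Real.exp_lt_one_iff.2 (by linarith))
  have hlog := mul_le_mul_of_nonneg_left (neg_log_one_sub_exp_neg_sq_le ht hT h)
    (by positivity : 0 ≤ 2 * Real.exp (-T) ^ 3)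
  rw [aFun_eq_exp_neg hT, div_le_iff₀ (by positivity)]
  linarith
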